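/- Let A be a real d×d matrix with A^d = 0 (in particular, this holds whenever the directed graph associated to A is acyclic), and let Σ be a symmetric positive-definite real d×d matrix. Then the forecast error variance contributions stabilize after d steps: for all indices j, k and every horizon h ≥ d, w_{h,jk} = w_{d,jk}. Hence the Bayesian Spillover Graph of a DAG-structured VAR(1) reaches its equilibrium state at horizon at most d. -/

import Mathlib

open Matrix Finset

/-- Numerator of the `h`-step forecast error variance contribution from component `k`
to component `j`: `σ_kk⁻¹ ∑_{i=0}^{h-1} (e_jᵀ A^i Σ e_k)²`. -/
noncomputable def fevdNum {d : ℕ} (A S : Matrix (Fin d) (Fin d) ℝ)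
    (h : ℕ) (j k : Fin d) : ℝ :=
  (S k k)⁻¹ * ∑ i ∈ Finset.range h, ((A ^ i * S) j k) ^ 2

/-- Denominator of the `h`-step forecast error variance contribution:
`∑_{i=0}^{h-1} e_jᵀ A^i Σ (A^i)ᵀ e_j`. -/
noncomputable def fevdDen {d : ℕ} (A S : Matrix (Fin d) (Fin d) ℝ)
    (h : ℕ) (j : Fin d) : ℝ :=
  ∑ i ∈ Finset.range h, (A ^ i * S * (A ^ i)ᵀ) j j

/-- The `h`-step forecast error variance contribution `w_{h,jk}`. -/
noncomputable def fevdW {d : ℕ} (A S : Matrix (Fin d) (Fin d) ℝ)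
    (h : ℕ) (j k : Fin d) : ℝ :=
  fevdNum A S h j k / fevdDen A S h j

/-- If `A ^ d = 0` (as holds whenever the directed graph associated to `A` is acyclic)
and `Σ` is symmetric positive definite, then the forecast error variance contributions
stabilize after `d` steps: `w_{h,jk} = w_{d,jk}` for every horizon `h ≥ d`. The
Bayesian Spillover Graph of a DAG-structured VAR(1) reaches equilibrium at horizon at
most `d`. -/
theorem fevd_stabilizes_of_nilpotent {d : ℕ} (A S : Matrix (Fin d) (Fin d) ℝ)
    (hA : A ^ d = 0) (hS : S.PosDef) :
    ∀ j k : Fin d, ∀ h : ℕ, d ≤ h → fevdW A S h j k = fevdW A S d j k := by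
  intro j k h hdh
  have hpow : ∀ i, d ≤ i → A ^ i = 0 := fun i hi => pow_eq_zero_of_le hi hA
  have hsub : Finset.range d ⊆ Finset.range h := Finset.range_subset_range.2 hdh
  have hnum : fevdNum A S h j k = fevdNum A S d j k := by
    unfold fevdNum
    congr 1
    symm
    apply Finset.sum_subset hsub
    intro i _ hi
    rw [hpow i (by simpa using hi)]
    simp
  have hden : fevdDen A S h j = fevdDen A S d j := by
    unfold fevdDen
    symm
    apply Finset.sum_subset hsub
    intro i _ hi
    rw [hpow i (by simpa using hi)]
    simp
  unfold fevdW
  rw [hnum, hden]
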